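/- arXiv:2602.01248 — 5 statements merged into one kernel-verified Lean document; each statement's English description precedes it below -/
import Mathlib

section
/- Fix L, D > 0 and set α := L²/(4D), and let Φ(x) := (L/√(4πD)) e^{−3x/4} ∑_{m ∈ ℤ, m ≠ 0} exp(−α m² e^{−x}). Then there exist constants C > 0 and c > 0 (depending only on L and D) such that Φ(x) ≤ C e^{−x/4} for all x ≥ 0 and Φ(x) ≤ C e^{−3x/4} exp(−c e^{−x}) for all x ≤ 0; consequently Φ is (Lebesgue) integrable on ℝ. -/
open Real

theorem summable_exp_neg_mul_int_sq {t : ℝ} (ht : 0 < t) :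
    Summable fun n : ℤ ↦ exp (-t * (n : ℝ) ^ 2) := by
  have h : Summable fun n : ℕ ↦ exp (-t * (n : ℝ) ^ 2) := by
    have := Real.summable_exp_nat_mul_of_ge (neg_lt_zero.mpr ht) (f := fun n : ℕ ↦ (n : ℝ) ^ 2)
      (fun n ↦ by exact_mod_cast Nat.le_self_pow two_ne_zero n)
    simpa using this
  exact Summable.of_nat_of_neg (by simpa using h) (by simpa using h)

theorem tsum_exp_neg_mul_int_sq_le {a t : ℝ} (ht : 0 < t) (hta : t ≤ a) :
    ∑' n : ℤ, exp (-t * (n : ℝ) ^ 2) ≤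
      √(π / t) * ∑' n : ℤ, exp (-(π ^ 2 / a) * (n : ℝ) ^ 2) := by
  have hπ := pi_pos
  have ha : 0 < a := ht.trans_le hta
  have h := Real.tsum_exp_neg_mul_int_sq (div_pos ht hπ)
  have e1 : -π * (t / π) = -t := by field_simp
  have e2 : -π / (t / π) = -(π ^ 2 / t) := by field_simp
  rw [e1, e2, ← sqrt_eq_rpow, one_div, ← sqrt_inv, inv_div] at h
  rw [h]
  refine mul_le_mul_of_nonneg_left ?_ (sqrt_nonneg _)
  refine (summable_exp_neg_mul_int_sq (by positivity)).tsum_le_tsum (fun n ↦ ?_)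
    (summable_exp_neg_mul_int_sq (by positivity))
  gcongr

theorem tsum_ne_zero_exp_neg_mul_int_sq_le {a t : ℝ} (ha : 0 < a) (hat : a ≤ t) :
    ∑' m : {m : ℤ // m ≠ 0}, exp (-t * ((m : ℤ) : ℝ) ^ 2) ≤
      exp (-(t / 2)) * ∑' n : ℤ, exp (-(a / 2) * (n : ℝ) ^ 2) := by
  have hs := summable_exp_neg_mul_int_sq (half_pos ha)
  calc ∑' m : {m : ℤ // m ≠ 0}, exp (-t * ((m : ℤ) : ℝ) ^ 2)
      ≤ ∑' m : {m : ℤ // m ≠ 0}, exp (-(t / 2)) * exp (-(a / 2) * ((m : ℤ) : ℝ) ^ 2) := by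
        refine Summable.tsum_le_tsum (fun m ↦ ?_)
          ((summable_exp_neg_mul_int_sq (ha.trans_le hat)).subtype _)
          ((hs.subtype _).mul_left _)
        rw [← exp_add, exp_le_exp]
        have hm : (1 : ℝ) ≤ ((m : ℤ) : ℝ) ^ 2 := by
          have h1 : 0 < (m : ℤ) ^ 2 := sq_pos_of_ne_zero m.2
          exact_mod_cast h1
        nlinarith
    _ = exp (-(t / 2)) * ∑' m : {m : ℤ // m ≠ 0}, exp (-(a / 2) * ((m : ℤ) : ℝ) ^ 2) :=
        tsum_mul_left
    _ ≤ _ := by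
        gcongr
        exact hs.tsum_subtype_le (fun n : ℤ ↦ exp (-(a / 2) * (n : ℝ) ^ 2)) {m : ℤ | m ≠ 0}
          (fun _ ↦ (exp_pos _).le)

/-- A function with two-sided tail bounds of the type satisfied by the logarithmic kernel is
integrable. -/
theorem integrable_of_tail_bounds {f : ℝ → ℝ} (hf : Measurable f) (hf0 : ∀ x, 0 ≤ f x)
    {C c : ℝ} (hC : 0 < C) (hc : 0 < c) (hpos : ∀ x, 0 ≤ x → f x ≤ C * exp (-x / 4))
    (hneg : ∀ x, x ≤ 0 → f x ≤ C * exp (-3 * x / 4) * exp (-c * exp (-x))) :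
    MeasureTheory.Integrable f := by
  rw [← MeasureTheory.integrableOn_univ, ← Set.Iic_union_Ioi (a := (0 : ℝ))]
  refine MeasureTheory.IntegrableOn.union ?_ ?_
  · refine MeasureTheory.Integrable.mono'
      ((integrableOn_exp_mul_Iic (a := 1 / 4) (by norm_num) 0).const_mul (C / c))
      hf.aestronglyMeasurable ?_
    filter_upwards [MeasureTheory.ae_restrict_mem measurableSet_Iic] with x hx
    rw [norm_of_nonneg (hf0 x)]
    refine (hneg x hx).trans ?_
    have h1 : c * exp (-x) * exp (-c * exp (-x)) ≤ 1 := by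
      rw [neg_mul, exp_neg (c * exp (-x)), ← div_eq_mul_inv, div_le_one (exp_pos _)]
      linarith [add_one_le_exp (c * exp (-x))]
    have h2 : exp (-3 * x / 4) = exp (1 / 4 * x) * exp (-x) := by
      rw [← exp_add]; ring_nf
    calc C * exp (-3 * x / 4) * exp (-c * exp (-x))
        = C / c * exp (1 / 4 * x) * (c * exp (-x) * exp (-c * exp (-x))) := by
          rw [h2]; field_simp
      _ ≤ C / c * exp (1 / 4 * x) * 1 := by gcongr
      _ = _ := mul_one _
  · refine MeasureTheory.Integrable.mono'
      ((integrableOn_exp_mul_Ioi (a := -1 / 4) (by norm_num) 0).const_mul C)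
      hf.aestronglyMeasurable ?_
    filter_upwards [MeasureTheory.ae_restrict_mem measurableSet_Ioi] with x hx
    rw [norm_of_nonneg (hf0 x)]
    refine (hpos x (le_of_lt hx)).trans_eq ?_
    ring_nf

/-- tail bounds for the logarithmic kernel `Φ` and integrability. -/
theorem stmt_3 (L D : ℝ) (hL : 0 < L) (hD : 0 < D)
    (α : ℝ) (hα : α = L ^ 2 / (4 * D))
    (Φ : ℝ → ℝ)
    (hΦ : ∀ x : ℝ, Φ x = (L / Real.sqrt (4 * π * D)) * Real.exp (-3 * x / 4) *
      ∑' m : {m : ℤ // m ≠ 0}, Real.exp (-α * (m : ℝ) ^ 2 * Real.exp (-x))) :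
    ∃ C > (0 : ℝ), ∃ c > (0 : ℝ),
      (∀ x : ℝ, 0 ≤ x → Φ x ≤ C * Real.exp (-x / 4)) ∧
      (∀ x : ℝ, x ≤ 0 → Φ x ≤ C * Real.exp (-3 * x / 4) * Real.exp (-c * Real.exp (-x))) ∧
      MeasureTheory.Integrable Φ := by
  have hπ := pi_pos
  have hα0 : 0 < α := by rw [hα]; positivity
  have hA : 0 < L / √(4 * π * D) := by positivity
  set A := L / √(4 * π * D)
  have hΦ' : ∀ x, Φ x = A * exp (-3 * x / 4) *
      ∑' m : {m : ℤ // m ≠ 0}, exp (-(α * exp (-x)) * ((m : ℤ) : ℝ) ^ 2) := fun x ↦ by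
    rw [hΦ]
    congr 1
    exact tsum_congr fun m ↦ by ring_nf
  have hΦ0 : ∀ x, 0 ≤ Φ x := fun x ↦ by
    rw [hΦ]
    exact mul_nonneg (by positivity) (tsum_nonneg fun _ ↦ (exp_pos _).le)
  have hmeas : Measurable Φ := by
    rw [funext hΦ]
    refine Measurable.mul (by fun_prop) (Measurable.tsum fun m ↦ by fun_prop)
  set K₁ := ∑' n : ℤ, exp (-(π ^ 2 / α) * (n : ℝ) ^ 2)
  set K₂ := ∑' n : ℤ, exp (-(α / 2) * (n : ℝ) ^ 2)
  have hK₁ : 0 ≤ K₁ := tsum_nonneg fun _ ↦ (exp_pos _).le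
  have hK₂ : 0 ≤ K₂ := tsum_nonneg fun _ ↦ (exp_pos _).le
  have hC : 0 < A * (√(π / α) * K₁ + K₂ + 1) := by positivity
  have hpos : ∀ x : ℝ, 0 ≤ x → Φ x ≤ A * (√(π / α) * K₁ + K₂ + 1) * exp (-x / 4) := by
    intro x hx
    have ht : 0 < α * exp (-x) := by positivity
    have hta : α * exp (-x) ≤ α := mul_le_of_le_one_right hα0.le (by simpa using hx)
    have hsub := (summable_exp_neg_mul_int_sq ht).tsum_subtype_le
      (fun n : ℤ ↦ exp (-(α * exp (-x)) * (n : ℝ) ^ 2)) {m : ℤ | m ≠ 0} (fun _ ↦ (exp_pos _).le)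
    have hsqrt : √(π / (α * exp (-x))) = √(π / α) * exp (x / 2) := by
      rw [exp_half, ← sqrt_mul (by positivity), exp_neg]
      congr 1
      field_simp
    have hexp : exp (-3 * x / 4) * exp (x / 2) = exp (-x / 4) := by
      rw [← exp_add]; ring_nf
    have hle := hsub.trans (tsum_exp_neg_mul_int_sq_le ht hta)
    rw [hsqrt] at hle
    calc Φ x ≤ A * exp (-3 * x / 4) * (√(π / α) * exp (x / 2) * K₁) := by
          rw [hΦ']
          exact mul_le_mul_of_nonneg_left hle (by positivity)
      _ = A * (√(π / α) * K₁) * exp (-x / 4) := by rw [← hexp]; ring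
      _ ≤ _ := by gcongr; linarith
  have hneg : ∀ x : ℝ, x ≤ 0 → Φ x ≤
      A * (√(π / α) * K₁ + K₂ + 1) * exp (-3 * x / 4) * exp (-(α / 2) * exp (-x)) := by
    intro x hx
    have hat : α ≤ α * exp (-x) := le_mul_of_one_le_right hα0.le (by simpa using hx)
    have hq : 0 ≤ √(π / α) * K₁ := by positivity
    calc Φ x ≤ A * exp (-3 * x / 4) * (exp (-(α * exp (-x) / 2)) * K₂) := by
          rw [hΦ']
          exact mul_le_mul_of_nonneg_left (tsum_ne_zero_exp_neg_mul_int_sq_le hα0 hat)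
            (by positivity)
      _ = A * K₂ * exp (-3 * x / 4) * exp (-(α / 2) * exp (-x)) := by ring_nf
      _ ≤ _ := by gcongr; linarith
  exact ⟨_, hC, α / 2, half_pos hα0, hpos, hneg,
    integrable_of_tail_bounds hmeas hΦ0 hC (half_pos hα0) hpos hneg⟩
end

section
/- Fix L, D > 0 and set α := L²/(4D), and let Φ(x) := (L/√(4πD)) e^{−3x/4} ∑_{m ∈ ℤ, m ≠ 0} exp(−α m² e^{−x}). Then for every s ∈ ℂ with Re(s) > −1/4, the function x ↦ Φ(x) e^{−s x} is (absolutely) integrable on ℝ. -/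
open Real

/-- The exponential decays faster than any power: `e^{-t} ≤ (t / p)^{-p}`. -/
lemma exp_neg_le_div_rpow {p t : ℝ} (hp : 0 < p) (ht : 0 < t) :
    Real.exp (-t) ≤ (t / p) ^ (-p) := by
  have h1 : t / p ≤ Real.exp (t / p) := by linarith [Real.add_one_le_exp (t / p)]
  have h2 : (t / p) ^ p ≤ Real.exp t := by
    calc (t / p) ^ p ≤ Real.exp (t / p) ^ p := Real.rpow_le_rpow (by positivity) h1 hp.le
      _ = Real.exp t := by rw [← Real.exp_mul, div_mul_cancel₀ _ hp.ne']
  rw [Real.exp_neg, Real.rpow_neg (by positivity)]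
  exact inv_anti₀ (by positivity) h2

lemma exp_theta_term_le {α p : ℝ} (hα : 0 < α) (hp : 0 < p) (x : ℝ) (m : {m : ℤ // m ≠ 0}) :
    Real.exp (-α * (m : ℝ) ^ 2 * Real.exp (-x)) ≤
      (α / p) ^ (-p) * Real.exp (p * x) * |((m : ℤ) : ℝ)| ^ (-(2 * p)) := by
  have hm : 0 < |((m : ℤ) : ℝ)| := abs_pos.2 (Int.cast_ne_zero.2 m.2)
  have h := exp_neg_le_div_rpow hp
    (show 0 < α * |((m : ℤ) : ℝ)| ^ 2 * Real.exp (-x) by positivity)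
  have e : α * |((m : ℤ) : ℝ)| ^ 2 * Real.exp (-x) / p =
      α / p * Real.exp (-x) * |((m : ℤ) : ℝ)| ^ (2 : ℝ) := by
    rw [Real.rpow_two]; ring
  rw [e, Real.mul_rpow (by positivity) (by positivity),
    Real.mul_rpow (by positivity) (by positivity), ← Real.exp_mul,
    ← Real.rpow_mul hm.le] at h
  convert h using 2
  · rw [sq_abs]; ring
  · ring_nf
  · ring_nf

lemma summable_abs_rpow_ne_zero {p : ℝ} (hp : 1 / 2 < p) :
    Summable fun m : {m : ℤ // m ≠ 0} => |((m : ℤ) : ℝ)| ^ (-(2 * p)) :=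
  (Real.summable_abs_int_rpow (b := 2 * p) (by linarith)).subtype _

lemma exists_theta_sum_le {α p : ℝ} (hα : 0 < α) (hp : 1 / 2 < p) :
    ∃ C : ℝ, ∀ x : ℝ,
      ∑' m : {m : ℤ // m ≠ 0}, Real.exp (-α * (m : ℝ) ^ 2 * Real.exp (-x)) ≤
        C * Real.exp (p * x) := by
  refine ⟨(α / p) ^ (-p) * ∑' m : {m : ℤ // m ≠ 0}, |((m : ℤ) : ℝ)| ^ (-(2 * p)), fun x => ?_⟩
  have hs := (summable_abs_rpow_ne_zero hp).mul_left ((α / p) ^ (-p) * Real.exp (p * x))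
  have hle := exp_theta_term_le hα (by linarith : 0 < p) x
  refine ((hs.of_nonneg_of_le (fun _ => (Real.exp_pos _).le) hle).tsum_le_tsum hle hs).trans ?_
  rw [tsum_mul_left]
  exact le_of_eq (by ring)

/-- for `Re s > −1/4`, `x ↦ Φ(x) e^{−s x}` is integrable on `ℝ`. -/
theorem stmt_4 (L D : ℝ) (hL : 0 < L) (hD : 0 < D)
    (α : ℝ) (hα : α = L ^ 2 / (4 * D))
    (Φ : ℝ → ℝ)
    (hΦ : ∀ x : ℝ, Φ x = (L / Real.sqrt (4 * π * D)) * Real.exp (-3 * x / 4) *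
      ∑' m : {m : ℤ // m ≠ 0}, Real.exp (-α * (m : ℝ) ^ 2 * Real.exp (-x))) :
    ∀ s : ℂ, -(1 / 4 : ℝ) < s.re →
      MeasureTheory.Integrable (fun x : ℝ => (Φ x : ℂ) * Complex.exp (-s * x)) := by
  intro s hs
  have hα0 : 0 < α := by rw [hα]; positivity
  have hmeas : Measurable Φ := by
    rw [funext hΦ]
    refine Measurable.mul (by fun_prop) (Measurable.tsum fun m => by fun_prop)
  have hsm : MeasureTheory.AEStronglyMeasurable
      (fun x : ℝ => (Φ x : ℂ) * Complex.exp (-s * x)) := by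
    refine Measurable.aestronglyMeasurable ?_
    fun_prop
  have hbound : ∀ p : ℝ, 1 / 2 < p → ∃ C : ℝ, ∀ x : ℝ,
      ‖(Φ x : ℂ) * Complex.exp (-s * x)‖ ≤ C * Real.exp ((p - 3 / 4 - s.re) * x) := by
    intro p hp
    obtain ⟨C, hC⟩ := exists_theta_sum_le hα0 hp
    refine ⟨L / Real.sqrt (4 * π * D) * C, fun x => ?_⟩
    have hΦ0 : 0 ≤ Φ x := by
      rw [hΦ]
      exact mul_nonneg (by positivity) (tsum_nonneg fun _ => (Real.exp_pos _).le)
    have hexp : Real.exp ((p - 3 / 4 - s.re) * x) =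
        Real.exp (-3 * x / 4) * Real.exp (p * x) * Real.exp (-s.re * x) := by
      rw [← Real.exp_add, ← Real.exp_add]; ring_nf
    have hnorm : ‖(Φ x : ℂ) * Complex.exp (-s * x)‖ = Φ x * Real.exp (-s.re * x) := by
      rw [norm_mul, Complex.norm_real, Complex.norm_exp, Real.norm_of_nonneg hΦ0]
      simp
    rw [hnorm, hΦ, hexp]
    calc _ ≤ L / Real.sqrt (4 * π * D) * Real.exp (-3 * x / 4) * (C * Real.exp (p * x)) *
          Real.exp (-s.re * x) := by
          gcongr
          exact hC x
      _ = _ := by ring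
  rw [← MeasureTheory.integrableOn_univ, ← Set.Iic_union_Ioi (a := (0 : ℝ))]
  refine MeasureTheory.IntegrableOn.union ?_ ?_
  · obtain ⟨C, hC⟩ := hbound (2 + s.re) (by linarith)
    exact ((integrableOn_exp_mul_Iic (by linarith) 0).const_mul C).mono' hsm.restrict
      (.of_forall hC)
  · obtain ⟨C, hC⟩ := hbound ((5 / 4 + s.re) / 2) (by linarith)
    exact ((integrableOn_exp_mul_Ioi (by linarith) 0).const_mul C).mono' hsm.restrict
      (.of_forall hC)
end

section
/- Fix L, D > 0 and set α := L²/(4D), and let Φ(x) := (L/√(4πD)) e^{−3x/4} ∑_{m ∈ ℤ, m ≠ 0} exp(−α m² e^{−x}). Then the function s ↦ ∫_ℝ Φ(x) e^{−s x} dx is complex-differentiable (holomorphic) at every point of the open half-plane { s ∈ ℂ : Re(s) > −1/4 }. -/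
open Real MeasureTheory

open Set Filter Topology Asymptotics HurwitzZeta

theorem evenKernel_zero_isBigO_nhdsGT_zero :
    evenKernel 0 =O[𝓝[>] 0] fun t : ℝ => t ^ (-(1 / 2) : ℝ) := by
  obtain ⟨p, hp, h⟩ := isBigO_atTop_cosKernel_sub 0
  have hbdd : (fun x => cosKernel 0 x) =O[atTop] fun _ => (1 : ℝ) := by
    have hexp : (fun x : ℝ => rexp (-p * x)) =O[atTop] fun _ => (1 : ℝ) := by
      refine IsBigO.of_bound 1 ?_
      filter_upwards [eventually_ge_atTop 0] with x hx
      simpa using mul_nonneg hp.le hx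
    simpa using (h.trans hexp).add (isBigO_refl (fun _ : ℝ => (1 : ℝ)) atTop)
  have hcos : (fun t : ℝ => cosKernel 0 (1 / t)) =O[𝓝[>] 0] fun _ => (1 : ℝ) := by
    simpa [Function.comp_def] using hbdd.comp_tendsto tendsto_inv_nhdsGT_zero
  have hmul := (isBigO_refl (fun t : ℝ => t ^ (-(1 / 2) : ℝ)) (𝓝[>] 0)).mul hcos
  refine hmul.congr' ?_ ?_
  · filter_upwards [self_mem_nhdsWithin] with t ht
    rw [evenKernel_functional_equation, rpow_neg (le_of_lt ht), one_div (t ^ (1 / 2 : ℝ))]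
  · simp

theorem evenKernel_zero_sub_one_isBigO_nhdsGT_zero :
    (fun t => evenKernel 0 t - 1) =O[𝓝[>] 0] fun t : ℝ => t ^ (-(1 / 2) : ℝ) := by
  refine evenKernel_zero_isBigO_nhdsGT_zero.sub (IsBigO.of_bound 1 ?_)
  filter_upwards [Ioo_mem_nhdsGT (zero_lt_one (α := ℝ))] with t ht
  rw [norm_one, one_mul]
  exact (one_le_rpow_of_pos_of_le_one_of_nonpos ht.1 ht.2.le (by norm_num)).trans (le_abs_self _)

theorem differentiableAt_mellin_evenKernel_zero_sub_one {s : ℂ} (hs : 1 / 2 < s.re) :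
    DifferentiableAt ℂ (mellin fun t => ((evenKernel 0 t - 1 : ℝ) : ℂ)) s := by
  obtain ⟨p, hp, h⟩ := isBigO_atTop_evenKernel_sub 0
  simp only [if_true] at h
  refine mellin_differentiableAt_of_isBigO_rpow_exp hp ?_ (Complex.isBigO_ofReal_left.mpr h)
    (Complex.isBigO_ofReal_left.mpr evenKernel_zero_sub_one_isBigO_nhdsGT_zero) hs
  refine ContinuousOn.locallyIntegrableOn ?_ measurableSet_Ioi
  exact Complex.continuous_ofReal.comp_continuousOn
    ((continuousOn_evenKernel 0).sub continuousOn_const)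

theorem mellin_eq_integral_comp_exp_neg (f : ℝ → ℂ) (s : ℂ) :
    mellin f s = ∫ x : ℝ, f (rexp (-x)) * Complex.exp (-s * x) := by
  have himage : (fun x : ℝ => rexp (-x)) '' univ = Ioi 0 := by
    rw [← Real.range_exp, image_univ]
    exact neg_surjective.range_comp rexp
  have hderiv : ∀ x ∈ (univ : Set ℝ),
      HasDerivWithinAt (fun x : ℝ => rexp (-x)) (-rexp (-x)) univ x := fun x _ => by
    simpa using (hasDerivAt_neg x).exp
  have hinj : InjOn (fun x : ℝ => rexp (-x)) univ :=
    (Real.exp_injective.comp neg_injective).injOn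
  rw [mellin, ← himage, integral_image_eq_integral_abs_deriv_smul MeasurableSet.univ hderiv hinj,
    setIntegral_univ]
  congr 1
  ext x
  have hcpow : ((rexp (-x) : ℝ) : ℂ) ^ (s - 1) = Complex.exp (-x * (s - 1)) := by
    rw [Complex.cpow_def_of_ne_zero (by exact_mod_cast (Real.exp_pos _).ne'),
      ← Complex.ofReal_log (Real.exp_pos _).le, Real.log_exp]
    push_cast
    rfl
  rw [hcpow, abs_neg, abs_of_pos (Real.exp_pos _), Complex.real_smul, smul_eq_mul, ← mul_assoc,
    Complex.ofReal_exp, ← Complex.exp_add, mul_comm]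
  congr 2
  push_cast
  ring

theorem tsum_exp_neg_mul_int_sq_ne_zero {t : ℝ} (ht : 0 < t) :
    ∑' m : {m : ℤ // m ≠ 0}, rexp (-π * (m : ℝ) ^ 2 * t) = evenKernel 0 t - 1 := by
  have h := hasSum_int_evenKernel₀ 0 ht
  simp only [QuotientAddGroup.mk_zero, if_true, add_zero, Int.cast_eq_zero] at h
  rw [← h.tsum_eq]
  refine (tsum_subtype {m : ℤ | m ≠ 0} fun m : ℤ => rexp (-π * (m : ℝ) ^ 2 * t)).trans ?_
  congr 1
  ext m
  by_cases hm : m = 0 <;> simp [hm]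

/-- the bilateral Laplace transform `s ↦ ∫ Φ(x) e^{−s x} dx` is
holomorphic on the half-plane `Re s > −1/4`. -/
theorem stmt_5 (L D : ℝ) (hL : 0 < L) (hD : 0 < D)
    (α : ℝ) (hα : α = L ^ 2 / (4 * D))
    (Φ : ℝ → ℝ)
    (hΦ : ∀ x : ℝ, Φ x = (L / Real.sqrt (4 * π * D)) * Real.exp (-3 * x / 4) *
      ∑' m : {m : ℤ // m ≠ 0}, Real.exp (-α * (m : ℝ) ^ 2 * Real.exp (-x))) :
    ∀ s : ℂ, -(1 / 4 : ℝ) < s.re →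
      DifferentiableAt ℂ (fun z : ℂ => ∫ x : ℝ, (Φ x : ℂ) * Complex.exp (-z * x)) s := by
  intro s hs
  have hβ : 0 < α / π := by rw [hα]; positivity
  have hΦ' : ∀ x, Φ x = (L / √(4 * π * D)) * rexp (-3 * x / 4) *
      (evenKernel 0 (α / π * rexp (-x)) - 1) := fun x => by
    rw [hΦ, ← tsum_exp_neg_mul_int_sq_ne_zero (mul_pos hβ (Real.exp_pos _))]
    congr! 4 with m
    field_simp
  have hmellin : (fun z : ℂ => ∫ x : ℝ, (Φ x : ℂ) * Complex.exp (-z * x)) = fun z =>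
      ((L / √(4 * π * D) : ℝ) : ℂ) * (((α / π : ℝ) : ℂ) ^ (-(z + 3 / 4)) *
        mellin (fun t => ((evenKernel 0 t - 1 : ℝ) : ℂ)) (z + 3 / 4)) := by
    ext z
    rw [← smul_eq_mul (_ ^ _), ← mellin_comp_mul_left _ _ hβ, mellin_eq_integral_comp_exp_neg,
      ← integral_const_mul]
    congr 1
    ext x
    have hexp : Complex.exp (-(z + 3 / 4) * x) =
        ((rexp (-3 * x / 4) : ℝ) : ℂ) * Complex.exp (-z * x) := by
      rw [Complex.ofReal_exp, ← Complex.exp_add]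
      congr 1
      push_cast
      ring
    rw [hΦ', hexp]
    push_cast
    ring
  rw [hmellin]
  have hs' : 1 / 2 < (s + 3 / 4).re := by
    have : (s + 3 / 4).re = s.re + 3 / 4 := by norm_num
    linarith
  have hβ' : ((α / π : ℝ) : ℂ) ≠ 0 := by exact_mod_cast hβ.ne'
  have hmel := (differentiableAt_mellin_evenKernel_zero_sub_one hs').comp s
    (f := fun z : ℂ => z + 3 / 4) (by fun_prop)
  have hpow : DifferentiableAt ℂ (fun z : ℂ => ((α / π : ℝ) : ℂ) ^ (-(z + 3 / 4))) s :=
    DifferentiableAt.const_cpow (by fun_prop) (Or.inl hβ')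
  exact (hpow.mul hmel).const_mul _
end

section
/- Fix u > 0 and define φ_u(x) := e^{−u e^{−x}} for x ∈ ℝ. Then φ_u belongs to PF_∞: for every n ≥ 1 and all strictly increasing real sequences x₁ < ⋯ < xₙ and y₁ < ⋯ < yₙ, det( φ_u(x_i − y_j) )_{1 ≤ i,j ≤ n} ≥ 0. -/
/-- A function `f : ℝ → ℝ` is a Pólya frequency function of infinite order if
all translation determinants with strictly increasing nodes are nonnegative. -/
def IsPFinfty (f : ℝ → ℝ) : Prop :=
  ∀ (n : ℕ), 1 ≤ n → ∀ (x y : Fin n → ℝ), StrictMono x → StrictMono y →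
    0 ≤ (Matrix.of fun i j => f (x i - y j)).det

/-- If the determinant with rows `g' (t i)` is nonnegative whenever each `t i` lies in
`(p i, q i)`, then so is the determinant with rows `g (q i) - g (p i)`. -/
theorem Matrix.det_sub_nonneg_of_det_deriv_nonneg {n : Type*} [Fintype n] [DecidableEq n]
    {g g' : ℝ → n → ℝ} (hg : ∀ x, HasDerivAt g (g' x) x) {p q : n → ℝ} (hpq : ∀ i, p i ≤ q i)
    (h : ∀ t : n → ℝ, (∀ i, t i ∈ Set.Ioo (p i) (q i)) →
      0 ≤ (Matrix.of fun i => g' (t i)).det) :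
    0 ≤ (Matrix.of fun i => g (q i) - g (p i)).det := by
  suffices H : ∀ (s : Finset n) (t : n → ℝ), (∀ i, i ∉ s → t i ∈ Set.Ioo (p i) (q i)) →
      0 ≤ (Matrix.of fun i => if i ∈ s then g (q i) - g (p i) else g' (t i)).det by
    simpa using H Finset.univ p (by simp)
  intro s
  induction s using Finset.induction_on with
  | empty => simpa using h
  | insert k s hk ih =>
    intro t ht
    set M : Matrix n n ℝ :=
      Matrix.of fun i => if i ∈ insert k s then g (q i) - g (p i) else g' (t i) with hM
    let L : (n → ℝ) →ₗ[ℝ] ℝ := LinearMap.proj k ∘ₗ M.transpose.cramer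
    have hL (b : n → ℝ) : L b = (M.updateRow k b).det := M.cramer_transpose_apply b k
    have hd (x : ℝ) : HasDerivAt (fun x => L (g x)) (L (g' x)) x :=
      L.toContinuousLinearMap.hasFDerivAt.comp_hasDerivAt x (hg x)
    have hmono : MonotoneOn (fun x => L (g x)) (Set.Icc (p k) (q k)) := by
      refine monotoneOn_of_hasDerivWithinAt_nonneg (convex_Icc _ _)
        (fun x _ => (hd x).continuousAt.continuousWithinAt)
        (fun x _ => (hd x).hasDerivWithinAt) fun x hx => ?_
      rw [interior_Icc] at hx
      rw [hL]
      convert ih (Function.update t k x) fun i hi => ?_ using 2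
      · ext i j
        by_cases hik : i = k
        · subst hik
          simp [hk]
        · simp [hM, hik]
      · by_cases hik : i = k
        · subst hik
          simpa using hx
        · simpa [hik] using ht i (by simp [hik, hi])
    have hle := hmono (Set.left_mem_Icc.2 (hpq k)) (Set.right_mem_Icc.2 (hpq k)) (hpq k)
    have hrow : M.updateRow k (g (q k) - g (p k)) = M := by
      have hMk : M k = g (q k) - g (p k) := by
        ext j
        simp [hM]
      rw [← hMk, Matrix.updateRow_eq_self]
    rw [← hrow, ← hL, map_sub]
    exact sub_nonneg.2 hle

/-- The exponential kernel `(a, b) ↦ exp (a * b)` is totally nonnegative. -/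
theorem Real.det_exp_mul_nonneg {n : ℕ} {a b : Fin n → ℝ} (ha : StrictMono a)
    (hb : StrictMono b) : 0 ≤ (Matrix.of fun i j => Real.exp (a i * b j)).det := by
  induction n with
  | zero => simp
  | succ n ih =>
    let c : Fin n → ℝ := fun j => b j.succ - b 0
    have hc (j : Fin n) : 0 < c j := sub_pos.2 (hb j.succ_pos)
    let g : ℝ → Fin n → ℝ := fun x j => Real.exp (x * c j)
    let A : Matrix (Fin (n + 1)) (Fin (n + 1)) ℝ :=
      Matrix.of fun i j => Real.exp (a i * (b j - b 0))
    let B : Matrix (Fin (n + 1)) (Fin (n + 1)) ℝ :=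
      Matrix.of (Fin.cons (A 0) fun i => A i.succ - A i.castSucc)
    have hfactor : (Matrix.of fun i j => Real.exp (a i * b j)).det =
        (∏ i, Real.exp (a i * b 0)) * A.det := by
      rw [← Matrix.det_mul_column]
      congr 1
      ext i j
      simp only [A, Matrix.of_apply, ← Real.exp_add]
      ring_nf
    have hAB : A.det = B.det :=
      Matrix.det_eq_of_forall_row_eq_smul_add_pred (fun _ => 1) (fun j => by simp [B])
        (fun i j => by simp [B])
    have hB : B.det = (Matrix.of fun i : Fin n => g (a i.succ) - g (a i.castSucc)).det := by
      rw [Matrix.det_succ_column_zero, Fin.sum_univ_succ, Finset.sum_eq_zero]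
      · simp only [B, A, Fin.val_zero, pow_zero, Matrix.of_apply, Fin.cons_zero, sub_self,
          mul_zero, Real.exp_zero, one_mul, add_zero]
        congr 1
      · intro i _
        simp [B, A]
    rw [hfactor, hAB, hB]
    refine mul_nonneg (Finset.prod_nonneg fun _ _ => (Real.exp_pos _).le) ?_
    refine Matrix.det_sub_nonneg_of_det_deriv_nonneg (g' := fun x j => c j * Real.exp (x * c j))
      (fun x => hasDerivAt_pi.2 fun j => ?_) (fun i => (ha i.castSucc_lt_succ).le) fun t ht => ?_
    · simpa [g, mul_comm] using ((hasDerivAt_id x).mul_const (c j)).exp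
    · have hfac := Matrix.det_mul_row c (Matrix.of fun i j => Real.exp (t i * c j))
      simp only [Matrix.of_apply] at hfac
      rw [hfac]
      refine mul_nonneg (Finset.prod_nonneg fun j _ => (hc j).le) (ih ?_ ?_)
      · intro i j hij
        exact (ht i).2.trans_le ((ha.monotone (Fin.succ_le_castSucc_iff.2 hij)).trans (ht j).1.le)
      · intro i j hij
        exact sub_lt_sub_right (hb (Fin.succ_lt_succ_iff.2 hij)) _

/-- for `u > 0`, the kernel `φ_u(x) := e^{−u e^{−x}}` is `PF_∞`. -/
theorem stmt_13 (u : ℝ) (hu : 0 < u) :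
    IsPFinfty (fun x : ℝ => Real.exp (-u * Real.exp (-x))) := by
  intro n _ x y hx hy
  have ha : StrictMono fun i => -u * Real.exp (-x i) := fun i j hij =>
    mul_lt_mul_of_neg_left (Real.exp_lt_exp.2 (neg_lt_neg (hx hij))) (neg_neg_of_pos hu)
  convert Real.det_exp_mul_nonneg ha (Real.exp_strictMono.comp hy) using 5 with i j
  rw [Function.comp_apply, mul_assoc, ← Real.exp_add]
  ring_nf
end

section
/- Let Θ(t) := ∑_{n=1}^∞ (2π² n⁴ t^{3/2} − 3π n² t^{1/2}) e^{−π n² t} for t > 0. Then for every s ∈ ℂ the function t ↦ Θ(t) t^{s−1} is (absolutely) integrable on (0, ∞), and the Mellin transform M(s) := ∫₀^∞ Θ(t) t^{s−1} dt defines an entire function of s (complex-differentiable at every point of ℂ). -/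
open Real MeasureTheory

open Filter Topology Asymptotics Set

/-- The one-sided theta series `∑_{n ≥ 1} n ^ k e^{-π n² t}`. -/
noncomputable def thetaMoment (k : ℕ) (t : ℝ) : ℝ :=
  ∑' n : ℕ, ((n : ℝ) + 1) ^ k * Real.exp (-π * ((n : ℝ) + 1) ^ 2 * t)

lemma summable_thetaMoment (k : ℕ) {t : ℝ} (ht : 0 < t) :
    Summable fun n : ℕ => ((n : ℝ) + 1) ^ k * Real.exp (-π * ((n : ℝ) + 1) ^ 2 * t) := by
  have h := (summable_nat_add_iff 1).2
    (summable_pow_mul_exp_neg_nat_mul k (mul_pos pi_pos ht))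
  refine h.of_nonneg_of_le (fun n => by positivity) fun n => ?_
  push_cast
  refine mul_le_mul_of_nonneg_left (Real.exp_le_exp.2 ?_) (by positivity)
  have hn : (0 : ℝ) ≤ n := n.cast_nonneg
  have hπt := mul_pos pi_pos ht
  nlinarith [mul_nonneg hπt.le (mul_nonneg hn (add_nonneg hn zero_le_one))]

lemma hasDerivAt_thetaMoment (k : ℕ) {t : ℝ} (ht : 0 < t) :
    HasDerivAt (thetaMoment k) (-π * thetaMoment (k + 2) t) t := by
  have hterm : ∀ (n : ℕ) (y : ℝ), y ∈ Ioi (t / 2) →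
      HasDerivAt (fun y : ℝ => ((n : ℝ) + 1) ^ k * Real.exp (-π * ((n : ℝ) + 1) ^ 2 * y))
        (-π * (((n : ℝ) + 1) ^ (k + 2) * Real.exp (-π * ((n : ℝ) + 1) ^ 2 * y))) y := by
    intro n y _
    have h := (((hasDerivAt_id y).const_mul (-π * ((n : ℝ) + 1) ^ 2)).exp).const_mul
      (((n : ℝ) + 1) ^ k)
    refine h.congr_deriv ?_
    simp only [id]
    ring
  have hmem : t ∈ Ioi (t / 2) := half_lt_self ht
  have h := hasDerivAt_tsum_of_isPreconnected
    ((summable_thetaMoment (k + 2) (half_pos ht)).mul_left π) isOpen_Ioi isPreconnected_Ioi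
    hterm (fun n y hy => ?_) hmem (summable_thetaMoment k ht) hmem
  · rwa [tsum_mul_left] at h
  · rw [norm_mul, norm_neg, Real.norm_of_nonneg pi_pos.le, Real.norm_of_nonneg (by positivity)]
    refine mul_le_mul_of_nonneg_left (mul_le_mul_of_nonneg_left (Real.exp_le_exp.2 ?_)
      (by positivity)) pi_pos.le
    have hy' : t / 2 ≤ y := le_of_lt hy
    have : 0 ≤ π * ((n : ℝ) + 1) ^ 2 := by positivity
    nlinarith

lemma thetaMoment_le (k : ℕ) {t : ℝ} (ht : 1 ≤ t) :
    thetaMoment k t ≤ thetaMoment k 1 * Real.exp (-π * (t - 1)) := by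
  unfold thetaMoment
  rw [← tsum_mul_right]
  refine (summable_thetaMoment k (by linarith)).tsum_le_tsum (fun n => ?_)
    ((summable_thetaMoment k one_pos).mul_right _)
  rw [mul_assoc (_ ^ k) (Real.exp _), ← Real.exp_add]
  refine mul_le_mul_of_nonneg_left (Real.exp_le_exp.2 ?_) (by positivity)
  have hn : (0 : ℝ) ≤ n := n.cast_nonneg
  have : 0 ≤ π * (t - 1) * (n ^ 2 + 2 * n) :=
    mul_nonneg (mul_nonneg pi_pos.le (by linarith)) (by positivity)
  nlinarith

lemma isBigO_rpow_mul_thetaMoment (r : ℝ) (k : ℕ) :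
    (fun t => t ^ r * thetaMoment k t) =O[atTop] fun t => Real.exp (-1 * t) := by
  have hk : thetaMoment k =O[atTop] fun t => Real.exp (-π * t) := by
    refine IsBigO.of_bound (thetaMoment k 1 * Real.exp π) ?_
    filter_upwards [eventually_ge_atTop 1] with t ht
    have hnonneg : 0 ≤ thetaMoment k t := tsum_nonneg fun n => by positivity
    rw [Real.norm_of_nonneg hnonneg, Real.norm_of_nonneg (by positivity), mul_assoc,
      ← Real.exp_add]
    convert thetaMoment_le k ht using 3
    ring
  have hr := (isLittleO_rpow_exp_pos_mul_atTop r one_pos).isBigO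
  refine (hr.mul hk).trans (IsBigO.of_bound 1 ?_)
  filter_upwards [eventually_ge_atTop 0] with t ht
  rw [← Real.exp_add, one_mul (‖_‖), Real.norm_of_nonneg (by positivity),
    Real.norm_of_nonneg (by positivity)]
  refine Real.exp_le_exp.2 ?_
  nlinarith [two_le_pi]

lemma thetaMoment_zero_functional_equation {t : ℝ} (ht : 0 < t) :
    1 + 2 * thetaMoment 0 t = t ^ (-(1 / 2) : ℝ) * (1 + 2 * thetaMoment 0 t⁻¹) := by
  have key : ∀ {u : ℝ}, 0 < u → HurwitzZeta.cosKernel 0 u = 1 + 2 * thetaMoment 0 u := by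
    intro u hu
    have h := (HurwitzZeta.hasSum_nat_cosKernel₀ 0 hu).tsum_eq
    simp only [mul_zero, zero_mul, Real.cos_zero, mul_one, tsum_mul_left,
      QuotientAddGroup.mk_zero] at h
    simp only [thetaMoment, pow_zero, one_mul]
    linarith
  have h := HurwitzZeta.evenKernel_functional_equation 0 t
  rw [HurwitzZeta.evenKernel_eq_cosKernel_of_zero, key ht, one_div t, key (inv_pos.2 ht)] at h
  rw [h, rpow_neg ht.le, one_div]

lemma hasDerivAt_thetaMoment_inv (k : ℕ) {t : ℝ} (ht : 0 < t) :
    HasDerivAt (fun u => thetaMoment k u⁻¹) (π * thetaMoment (k + 2) t⁻¹ / t ^ 2) t := by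
  refine ((hasDerivAt_thetaMoment k (inv_pos.2 ht)).comp t (hasDerivAt_inv ht.ne')).congr_deriv ?_
  field_simp

lemma thetaMoment_two_functional_equation {t : ℝ} (ht : 0 < t) :
    t ^ (3 / 2 : ℝ) * (-2 * π * thetaMoment 2 t) =
      -(1 / 2) * (1 + 2 * thetaMoment 0 t⁻¹) + 2 * π * (t⁻¹ * thetaMoment 2 t⁻¹) := by
  have hl := ((hasDerivAt_thetaMoment 0 ht).const_mul 2).const_add 1
  have hr := (Real.hasDerivAt_rpow_const (p := -(1 / 2)) (Or.inl ht.ne')).mul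
    (((hasDerivAt_thetaMoment_inv 0 ht).const_mul 2).const_add 1)
  have heq : (fun t => 1 + 2 * thetaMoment 0 t) =ᶠ[𝓝 t]
      fun t => t ^ (-(1 / 2) : ℝ) * (1 + 2 * thetaMoment 0 t⁻¹) := by
    filter_upwards [Ioi_mem_nhds ht] with u hu using thetaMoment_zero_functional_equation hu
  have h := hl.unique (hr.congr_of_eventuallyEq heq)
  have h1 : t ^ (3 / 2 : ℝ) * t ^ (-(1 / 2) - 1 : ℝ) = 1 := by
    rw [← rpow_add ht]; norm_num
  have h2 : t ^ (3 / 2 : ℝ) * t ^ (-(1 / 2) : ℝ) = t := by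
    rw [← rpow_add ht]; norm_num
  calc t ^ (3 / 2 : ℝ) * (-2 * π * thetaMoment 2 t)
      = t ^ (3 / 2 : ℝ) * (2 * (-π * thetaMoment (0 + 2) t)) := by ring_nf
    _ = (t ^ (3 / 2 : ℝ) * t ^ (-(1 / 2) - 1 : ℝ)) * (-(1 / 2) * (1 + 2 * thetaMoment 0 t⁻¹)) +
        (t ^ (3 / 2 : ℝ) * t ^ (-(1 / 2) : ℝ)) * (2 * (π * thetaMoment 2 t⁻¹ / t ^ 2)) := by
      rw [h]; ring_nf
    _ = _ := by
      rw [h1, h2]; field_simp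

/-- The combination of second and fourth moments occurring in the Riemann `Φ` function, and its
expression through the moments at `t⁻¹`. -/
lemma thetaMoment_four_functional_equation {t : ℝ} (ht : 0 < t) :
    2 * π ^ 2 * (t ^ (3 / 2 : ℝ) * thetaMoment 4 t) -
        3 * π * (t ^ (1 / 2 : ℝ) * thetaMoment 2 t) =
      2 * π ^ 2 * (t⁻¹ ^ (3 : ℝ) * thetaMoment 4 t⁻¹) -
        3 * π * (t⁻¹ ^ (2 : ℝ) * thetaMoment 2 t⁻¹) := by
  have hl := (Real.hasDerivAt_rpow_const (p := 3 / 2) (Or.inl ht.ne')).mul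
    ((hasDerivAt_thetaMoment 2 ht).const_mul (-2 * π))
  have hr := ((((hasDerivAt_thetaMoment_inv 0 ht).const_mul 2).const_add 1).const_mul
    (-(1 / 2))).add
    (((hasDerivAt_inv ht.ne').mul (hasDerivAt_thetaMoment_inv 2 ht)).const_mul (2 * π))
  have heq : (fun t => t ^ (3 / 2 : ℝ) * (-2 * π * thetaMoment 2 t)) =ᶠ[𝓝 t] fun t =>
      -(1 / 2) * (1 + 2 * thetaMoment 0 t⁻¹) + 2 * π * (t⁻¹ * thetaMoment 2 t⁻¹) := by
    filter_upwards [Ioi_mem_nhds ht] with u hu using thetaMoment_two_functional_equation hu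
  have h := hl.unique (hr.congr_of_eventuallyEq heq)
  norm_num at h
  have e3 : t⁻¹ ^ (3 : ℝ) = t⁻¹ ^ 3 := by exact_mod_cast rpow_natCast t⁻¹ 3
  have e2 : t⁻¹ ^ (2 : ℝ) = t⁻¹ ^ 2 := by exact_mod_cast rpow_natCast t⁻¹ 2
  rw [e3, e2]
  field_simp at h ⊢
  linarith

/-- for `Θ(t) := ∑_{n≥1} (2π² n⁴ t^{3/2} − 3π n² t^{1/2}) e^{−π n² t}`,
the Mellin integrand is absolutely integrable on `(0,∞)` for every `s ∈ ℂ`, and the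
Mellin transform `M(s) := ∫₀^∞ Θ(t) t^{s−1} dt` is an entire function of `s`. -/
theorem stmt_15
    (Θ : ℝ → ℝ)
    (hΘ : ∀ t : ℝ, Θ t = ∑' n : ℕ,
      (2 * π ^ 2 * ((n : ℝ) + 1) ^ 4 * t ^ ((3 : ℝ) / 2)
        - 3 * π * ((n : ℝ) + 1) ^ 2 * t ^ ((1 : ℝ) / 2))
        * Real.exp (-π * ((n : ℝ) + 1) ^ 2 * t)) :
    (∀ s : ℂ, IntegrableOn (fun t : ℝ => (Θ t : ℂ) * (t : ℂ) ^ (s - 1)) (Set.Ioi 0)) ∧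
    (∀ s : ℂ, DifferentiableAt ℂ
      (fun z : ℂ => ∫ t in Set.Ioi (0 : ℝ), (Θ t : ℂ) * (t : ℂ) ^ (z - 1)) s) := by
  have hΘ' : ∀ t : ℝ, 0 < t → Θ t = 2 * π ^ 2 * (t ^ (3 / 2 : ℝ) * thetaMoment 4 t) -
      3 * π * (t ^ (1 / 2 : ℝ) * thetaMoment 2 t) := by
    intro t ht
    rw [hΘ]
    unfold thetaMoment
    simp only [← tsum_mul_left]
    rw [← Summable.tsum_sub]
    · exact tsum_congr fun n => by ring
    · exact ((summable_thetaMoment 4 ht).mul_left _).mul_left _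
    · exact ((summable_thetaMoment 2 ht).mul_left _).mul_left _
  have hcont : ContinuousOn (fun t => (Θ t : ℂ)) (Ioi 0) := by
    have hmom : ∀ k, ContinuousOn (thetaMoment k) (Ioi 0) := fun k t ht =>
      (hasDerivAt_thetaMoment k ht).continuousAt.continuousWithinAt
    have hpow : ∀ r : ℝ, ContinuousOn (fun t : ℝ => t ^ r) (Ioi 0) := fun r t ht =>
      (Real.continuousAt_rpow_const t r (Or.inl (ne_of_gt ht))).continuousWithinAt
    refine Complex.continuous_ofReal.comp_continuousOn (ContinuousOn.congr ?_ hΘ')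
    exact (((hpow _).mul (hmom 4)).const_mul _).sub (((hpow _).mul (hmom 2)).const_mul _)
  have hloc : LocallyIntegrableOn (fun t => (Θ t : ℂ)) (Ioi 0) :=
    hcont.locallyIntegrableOn measurableSet_Ioi
  have hexp : ∀ a b : ℝ, (fun t => 2 * π ^ 2 * (t ^ a * thetaMoment 4 t) -
      3 * π * (t ^ b * thetaMoment 2 t)) =O[atTop] fun t => Real.exp (-1 * t) := fun a b =>
    ((isBigO_rpow_mul_thetaMoment a 4).const_mul_left _).sub
      ((isBigO_rpow_mul_thetaMoment b 2).const_mul_left _)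
  have htop : (fun t => (Θ t : ℂ)) =O[atTop] fun t => Real.exp (-1 * t) := by
    refine Complex.isBigO_ofReal_left.2 ((hexp (3 / 2) (1 / 2)).congr' ?_ EventuallyEq.rfl)
    filter_upwards [eventually_gt_atTop 0] with t ht using (hΘ' t ht).symm
  have hbot : ∀ b : ℝ, (fun t => (Θ t : ℂ)) =O[𝓝[>] 0] fun t : ℝ => t ^ (-b) := by
    intro b
    refine Complex.isBigO_ofReal_left.2 ((((hexp 3 2).trans
      (isLittleO_exp_neg_mul_rpow_atTop one_pos b).isBigO).comp_tendsto
      tendsto_inv_nhdsGT_zero).congr' ?_ ?_)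
    · filter_upwards [self_mem_nhdsWithin] with t ht
      rw [hΘ' t ht, thetaMoment_four_functional_equation ht]
      rfl
    · filter_upwards [self_mem_nhdsWithin] with t ht
      rw [Function.comp_apply, rpow_neg (le_of_lt ht), inv_rpow (le_of_lt ht)]
  refine ⟨fun s => ?_, fun s => ?_⟩
  · simpa only [MellinConvergent, smul_eq_mul, mul_comm] using
      mellinConvergent_of_isBigO_rpow_exp one_pos hloc htop (hbot (s.re - 1)) (sub_one_lt s.re)
  · refine (mellin_differentiableAt_of_isBigO_rpow_exp one_pos hloc htop (hbot (s.re - 1))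
      (sub_one_lt s.re)).congr_of_eventuallyEq (Eventually.of_forall fun z => ?_)
    simp only [mellin, smul_eq_mul, mul_comm]
end
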